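/- arXiv:1603.09219 — 3 statements merged into one kernel-verified Lean document; each statement's English description precedes it below -/
import Mathlib

section
/- Let {M_s}_{s≥0} be a sequence of positive reals with M_0 = 1 that is log-convex, i.e. M_k² ≤ M_{k−1} · M_{k+1} for all k ≥ 1. Then {M_s} is (FdB)-stable with constant C = max{1, M_1}: for every ℓ ≥ 1 and all positive integers α_1, …, α_ℓ with α_1 + … + α_ℓ = k, one has M_ℓ · M_{α_1} ··· M_{α_ℓ} ≤ (max{1, M_1})^k · M_k. -/
section LogConvex

variable {M : ℕ → ℝ}

/-- The successive quotients `M (k + 1) / M k` of a positive log-convex sequence increase. -/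
theorem logConvex_succ_mul_le (hMpos : ∀ s, 0 < M s)
    (hM : ∀ k : ℕ, 1 ≤ k → M k ^ 2 ≤ M (k - 1) * M (k + 1)) {p q : ℕ} (hpq : p ≤ q) :
    M (p + 1) * M q ≤ M p * M (q + 1) := by
  induction q, hpq using Nat.le_induction with
  | base => exact (mul_comm _ _).le
  | succ q _ ih =>
    have hq : M (q + 1) ^ 2 ≤ M q * M (q + 2) := hM (q + 1) (by omega)
    have hpos : 0 < M q * M (q + 1) := mul_pos (hMpos _) (hMpos _)
    refine le_of_mul_le_mul_right ?_ hpos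
    calc M (p + 1) * M (q + 1) * (M q * M (q + 1))
        = M (p + 1) * M q * M (q + 1) ^ 2 := by ring
      _ ≤ M p * M (q + 1) * (M q * M (q + 2)) :=
        mul_le_mul ih hq (sq_nonneg _) (mul_pos (hMpos _) (hMpos _)).le
      _ = M p * M (q + 1 + 1) * (M q * M (q + 1)) := by ring

/-- Shifting the index raises a positive log-convex sequence by a larger factor at larger indices. -/
theorem logConvex_add_mul_le (hMpos : ∀ s, 0 < M s)
    (hM : ∀ k : ℕ, 1 ≤ k → M k ^ 2 ≤ M (k - 1) * M (k + 1)) {p q : ℕ} (hpq : p ≤ q) (j : ℕ) :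
    M (p + j) * M q ≤ M p * M (q + j) := by
  induction j with
  | zero => rfl
  | succ j ih =>
    have hj := logConvex_succ_mul_le hMpos hM (Nat.add_le_add_right hpq j)
    have hpos : 0 < M (p + j) * M (q + j) := mul_pos (hMpos _) (hMpos _)
    refine le_of_mul_le_mul_right ?_ hpos
    calc M (p + (j + 1)) * M q * (M (p + j) * M (q + j))
        = M (p + j) * M q * (M (p + j + 1) * M (q + j)) := by ring_nf
      _ ≤ M p * M (q + j) * (M (p + j) * M (q + j + 1)) :=
        mul_le_mul ih hj (mul_pos (hMpos _) (hMpos _)).le (mul_pos (hMpos _) (hMpos _)).le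
      _ = M p * M (q + (j + 1)) * (M (p + j) * M (q + j)) := by ring_nf

theorem le_sum_of_forall_pos {l : ℕ} {α : Fin l → ℕ} (hα : ∀ i, 0 < α i) : l ≤ ∑ i, α i := by
  simpa using Finset.card_nsmul_le_sum Finset.univ α 1 fun i _ => hα i

/-- The stability estimate with the sharper constant `M 1 ^ l`, valid without normalizing `M 0`. -/
theorem logConvex_mul_prod_le (hMpos : ∀ s, 0 < M s)
    (hM : ∀ k : ℕ, 1 ≤ k → M k ^ 2 ≤ M (k - 1) * M (k + 1)) {l : ℕ} (α : Fin l → ℕ)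
    (hα : ∀ i, 0 < α i) : M l * ∏ i, M (α i) ≤ M 1 ^ l * M (∑ i, α i) := by
  induction l with
  | zero => simp
  | succ n ih =>
    rw [Fin.prod_univ_succ, Fin.sum_univ_succ]
    have htail : ∀ i : Fin n, 0 < α i.succ := fun i => hα _
    have hn := ih (fun i => α i.succ) htail
    have hle := le_sum_of_forall_pos htail
    obtain ⟨a, ha⟩ := Nat.exists_eq_add_of_le' (hα 0)
    rw [ha]
    generalize ∑ i : Fin n, α i.succ = S at hn hle ⊢
    have hP : 0 ≤ ∏ i : Fin n, M (α i.succ) := Finset.prod_nonneg fun i _ => (hMpos _).le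
    generalize ∏ i : Fin n, M (α i.succ) = P at hn hP ⊢
    have hstep := logConvex_succ_mul_le hMpos hM hle
    have hshift := logConvex_add_mul_le hMpos hM (Nat.le_add_left 1 S) a
    have hP' : M (n + 1) * P ≤ M 1 ^ n * M (S + 1) := by
      refine le_of_mul_le_mul_right ?_ (hMpos S)
      calc M (n + 1) * P * M S = M (n + 1) * M S * P := by ring
        _ ≤ M n * M (S + 1) * P := mul_le_mul_of_nonneg_right hstep hP
        _ = M n * P * M (S + 1) := by ring
        _ ≤ M 1 ^ n * M S * M (S + 1) := mul_le_mul_of_nonneg_right hn (hMpos _).le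
        _ = M 1 ^ n * M (S + 1) * M S := by ring
    calc M (n + 1) * (M (a + 1) * P) = M (n + 1) * P * M (a + 1) := by ring
      _ ≤ M 1 ^ n * M (S + 1) * M (a + 1) := mul_le_mul_of_nonneg_right hP' (hMpos _).le
      _ = M 1 ^ n * (M (1 + a) * M (S + 1)) := by rw [add_comm 1 a]; ring
      _ ≤ M 1 ^ n * (M 1 * M (S + 1 + a)) :=
        mul_le_mul_of_nonneg_left hshift (pow_pos (hMpos 1) n).le
      _ = M 1 ^ (n + 1) * M (a + 1 + S) := by
        rw [show S + 1 + a = a + 1 + S by omega]; ring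

end LogConvex

/-- A log-convex sequence of positive reals with `M 0 = 1` is
(FdB)-stable with constant `max 1 (M 1)`. -/
theorem logConvex_FdB_stable (M : ℕ → ℝ) (hMpos : ∀ s, 0 < M s) (hM0 : M 0 = 1)
    (hlogconvex : ∀ k : ℕ, 1 ≤ k → M k ^ 2 ≤ M (k - 1) * M (k + 1)) :
    ∀ (l k : ℕ) (α : Fin l → ℕ), 1 ≤ l → (∀ i, 0 < α i) → (∑ i, α i) = k →
      M l * ∏ i, M (α i) ≤ max 1 (M 1) ^ k * M k := by
  rintro l k α - hα rfl
  refine (logConvex_mul_prod_le hMpos hlogconvex α hα).trans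
    (mul_le_mul_of_nonneg_right ?_ (hMpos _).le)
  calc M 1 ^ l ≤ max 1 (M 1) ^ l := pow_le_pow_left₀ (hMpos 1).le (le_max_right _ _) l
    _ ≤ max 1 (M 1) ^ ∑ i, α i := pow_le_pow_right₀ (le_max_left _ _) (le_sum_of_forall_pos hα)
end

section
/- Let U ⊂ ℝ^d and V ⊂ ℝ^e be open, let B be a Banach space, and let {M_s}_{s≥0} be a sequence of positive reals that is log-superlinear and (FdB)-stable with some constant 0 < C_FdB ≤ 1. Let g : U → V and f : V → B be C^∞ maps, let K ⊂ U be compact, and suppose there exist constants C_g, R_g, C_f, R_f > 0 such that sup_{x∈K} ‖D^s g(x)‖ ≤ C_g · R_g^{−s} · s! · M_s and sup_{y∈g(K)} ‖D^s f(y)‖ ≤ C_f · R_f^{−s} · s! · M_s for all s ∈ ℕ. Then there exist constants C, R > 0 such that sup_{x∈K} ‖D^s (f∘g)(x)‖ ≤ C · R^{−s} · s! · M_s for all s ∈ ℕ. -/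
/-- The weighted Bell-type sum `∑ ℓ! ∏ a αᵢ!` over ordered partitions of `Fin n` with part sizes
`α₁, …, α_ℓ` is at most `n! (a + 2) ^ n`. -/
theorem OrderedFinpartition.sum_factorial_mul_prod_le {a : ℝ} (ha : 0 ≤ a) (n : ℕ) :
    ∑ c : OrderedFinpartition n,
      (c.length.factorial : ℝ) * ∏ i, a * ((c.partSize i).factorial : ℝ)
      ≤ (n.factorial : ℝ) * (a + 2) ^ n := by
  induction n with
  | zero => simp [OrderedFinpartition.default_eq, OrderedFinpartition.atomic]
  | succ n ih =>
    rw [← (OrderedFinpartition.extendEquiv n).sum_comp, Fintype.sum_sigma]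
    calc ∑ c : OrderedFinpartition n, ∑ o : Option (Fin c.length),
          (((c.extend o).length.factorial : ℝ) *
            ∏ i, a * (((c.extend o).partSize i).factorial : ℝ))
        ≤ ∑ c : OrderedFinpartition n, ((n + 1 : ℝ) * (a + 2)) *
            ((c.length.factorial : ℝ) * ∏ i, a * ((c.partSize i).factorial : ℝ)) := by
          refine Finset.sum_le_sum fun c _ => ?_
          have hleft : (((c.extend none).length.factorial : ℝ) *
              ∏ i, a * (((c.extend none).partSize i).factorial : ℝ)) =
              (a * (c.length + 1)) * ((c.length.factorial : ℝ) *
                ∏ i, a * ((c.partSize i).factorial : ℝ)) := by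
            change (((c.length + 1).factorial : ℝ) * ∏ i : Fin (c.length + 1),
              a * (((Fin.cons 1 c.partSize : Fin (c.length + 1) → ℕ) i).factorial : ℝ)) = _
            rw [Fin.prod_univ_succ, Nat.factorial_succ]
            simp only [Fin.cons_zero, Fin.cons_succ, Nat.factorial_one]
            push_cast
            ring
          have hmid : ∀ k, (((c.extend (some k)).length.factorial : ℝ) *
              ∏ i, a * (((c.extend (some k)).partSize i).factorial : ℝ)) =
              ((c.partSize k : ℝ) + 1) * ((c.length.factorial : ℝ) *
                ∏ i, a * ((c.partSize i).factorial : ℝ)) := by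
            intro k
            change ((c.length.factorial : ℝ) * ∏ i : Fin c.length,
              a * ((Function.update c.partSize k (c.partSize k + 1) i).factorial : ℝ)) = _
            rw [← Finset.mul_prod_erase _ _ (Finset.mem_univ k),
              ← Finset.mul_prod_erase Finset.univ (fun i => a * ((c.partSize i).factorial : ℝ))
                (Finset.mem_univ k)]
            have hcongr : ∏ i ∈ Finset.univ.erase k,
                a * ((Function.update c.partSize k (c.partSize k + 1) i).factorial : ℝ) =
                ∏ i ∈ Finset.univ.erase k, a * ((c.partSize i).factorial : ℝ) :=
              Finset.prod_congr rfl fun i hi => by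
                rw [Function.update_of_ne (Finset.ne_of_mem_erase hi)]
            rw [hcongr, Function.update_self, Nat.factorial_succ]
            push_cast
            ring
          have hsum : ∑ k, (c.partSize k : ℝ) = n := by
            have h := c.sum_sigma_eq_sum (fun _ => (1 : ℝ))
            simpa using h
          have hlen : (c.length : ℝ) ≤ n := by exact_mod_cast c.length_le
          rw [Fintype.sum_option]
          rw [hleft, Finset.sum_congr rfl fun k _ => hmid k, ← Finset.sum_mul, ← add_mul,
            Finset.sum_add_distrib, hsum]
          refine mul_le_mul_of_nonneg_right ?_ (by positivity)
          simp only [Finset.sum_const, Finset.card_univ, Fintype.card_fin, nsmul_eq_mul, mul_one]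
          nlinarith
      _ ≤ ((n + 1 : ℝ) * (a + 2)) * ((n.factorial : ℝ) * (a + 2) ^ n) := by
          rw [← Finset.mul_sum]
          exact mul_le_mul_of_nonneg_left ih (by positivity)
      _ = ((n + 1).factorial : ℝ) * (a + 2) ^ (n + 1) := by
          rw [Nat.factorial_succ]
          push_cast
          ring

/-- The Faà di Bruno bound: the norm of an iterated derivative of a composition is at most the sum,
over ordered partitions, of the products of the norms of the derivatives of the two maps. -/
theorem ContDiffOn.norm_iteratedFDerivWithin_comp_le_sum {𝕜 E F G : Type*}
    [NontriviallyNormedField 𝕜] [NormedAddCommGroup E] [NormedSpace 𝕜 E]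
    [NormedAddCommGroup F] [NormedSpace 𝕜 F] [NormedAddCommGroup G] [NormedSpace 𝕜 G]
    {g : E → F} {f : F → G} {U : Set E} {V : Set F} {n : ℕ}
    (hf : ContDiffOn 𝕜 n f V) (hg : ContDiffOn 𝕜 n g U)
    (hU : UniqueDiffOn 𝕜 U) (hV : UniqueDiffOn 𝕜 V) (hgV : Set.MapsTo g U V)
    {x : E} (hx : x ∈ U) :
    ‖iteratedFDerivWithin 𝕜 n (f ∘ g) U x‖ ≤ ∑ c : OrderedFinpartition n,
      ‖iteratedFDerivWithin 𝕜 c.length f V (g x)‖ *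
        ∏ i, ‖iteratedFDerivWithin 𝕜 (c.partSize i) g U x‖ := by
  rw [← ((hf.ftaylorSeriesWithin hV).comp (hg.ftaylorSeriesWithin hU)
    hgV).eq_iteratedFDerivWithin_of_uniqueDiffOn le_rfl hU hx]
  exact (norm_sum_le _ _).trans
    (Finset.sum_le_sum fun c _ => c.norm_compAlongOrderedFinpartition_le _ _)


/-- Stability under composition of ultradifferentiable bounds with a
log-superlinear, (FdB)-stable weight sequence. -/
theorem ultradifferentiable_composition_stability
    {d e : ℕ} {B : Type*} [NormedAddCommGroup B] [NormedSpace ℝ B]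
    (M : ℕ → ℝ) (hMpos : ∀ s, 0 < M s)
    (hLSL : ∀ k l : ℕ, M k * M l ≤ M 0 * M (k + l))
    (CFdB : ℝ) (hCFdB0 : 0 < CFdB) (hCFdB1 : CFdB ≤ 1)
    (hFdB : ∀ (l k : ℕ) (α : Fin l → ℕ), 1 ≤ l → (∀ i, 0 < α i) → (∑ i, α i) = k →
      M l * ∏ i, M (α i) ≤ CFdB ^ k * M k)
    (U : Set (Fin d → ℝ)) (V : Set (Fin e → ℝ)) (hU : IsOpen U) (hV : IsOpen V)
    (g : (Fin d → ℝ) → (Fin e → ℝ)) (f : (Fin e → ℝ) → B)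
    (hgV : Set.MapsTo g U V)
    (hg : ContDiffOn ℝ (⊤ : ℕ∞) g U) (hf : ContDiffOn ℝ (⊤ : ℕ∞) f V)
    (K : Set (Fin d → ℝ)) (hK : IsCompact K) (hKU : K ⊆ U)
    (Cg Rg Cf Rf : ℝ) (hCg : 0 < Cg) (hRg : 0 < Rg) (hCf : 0 < Cf) (hRf : 0 < Rf)
    (hgb : ∀ s : ℕ, ∀ x ∈ K,
      ‖iteratedFDerivWithin ℝ s g U x‖ ≤ Cg * Rg⁻¹ ^ s * (s.factorial : ℝ) * M s)
    (hfb : ∀ s : ℕ, ∀ x ∈ K,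
      ‖iteratedFDerivWithin ℝ s f V (g x)‖ ≤ Cf * Rf⁻¹ ^ s * (s.factorial : ℝ) * M s) :
    ∃ C R : ℝ, 0 < C ∧ 0 < R ∧
      ∀ s : ℕ, ∀ x ∈ K,
        ‖iteratedFDerivWithin ℝ s (f ∘ g) U x‖ ≤ C * R⁻¹ ^ s * (s.factorial : ℝ) * M s := by
  refine ⟨Cf, Rg / (Cg / Rf + 2), hCf, by positivity, fun n x hx => ?_⟩
  have hn : ((n : ℕ∞) : WithTop ℕ∞) ≤ ((⊤ : ℕ∞) : WithTop ℕ∞) := by exact_mod_cast le_top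
  refine ((hf.of_le hn).norm_iteratedFDerivWithin_comp_le_sum (hg.of_le hn)
    hU.uniqueDiffOn hV.uniqueDiffOn hgV (hKU hx)).trans ?_
  have hterm : ∀ c : OrderedFinpartition n,
      ‖iteratedFDerivWithin ℝ c.length f V (g x)‖ *
        ∏ i, ‖iteratedFDerivWithin ℝ (c.partSize i) g U x‖ ≤
      (Cf * Rg⁻¹ ^ n * M n) * ((c.length.factorial : ℝ) *
        ∏ i, Cg / Rf * ((c.partSize i).factorial : ℝ)) := by
    intro c
    have hsize : ∑ i, c.partSize i = n := by
      simpa using c.sum_sigma_eq_sum (fun _ => (1 : ℕ))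
    have hM : M c.length * ∏ i, M (c.partSize i) ≤ M n := by
      rcases Nat.eq_zero_or_pos n with rfl | hpos
      · have hlen : c.length = 0 := Nat.le_zero.mp c.length_le
        have : IsEmpty (Fin c.length) := by rw [hlen]; infer_instance
        simp [hlen]
      · refine (hFdB _ n c.partSize (c.length_pos hpos) c.partSize_pos hsize).trans ?_
        exact mul_le_of_le_one_left (hMpos n).le (pow_le_one₀ hCFdB0.le hCFdB1)
    calc ‖iteratedFDerivWithin ℝ c.length f V (g x)‖ *
          ∏ i, ‖iteratedFDerivWithin ℝ (c.partSize i) g U x‖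
        ≤ (Cf * Rf⁻¹ ^ c.length * (c.length.factorial : ℝ) * M c.length) *
          ∏ i, (Cg * Rg⁻¹ ^ c.partSize i * ((c.partSize i).factorial : ℝ) *
            M (c.partSize i)) := by
          have := (hMpos c.length).le
          gcongr with i
          · exact hfb _ x hx
          · exact hgb _ x hx
      _ = (Cf * Rg⁻¹ ^ n * (M c.length * ∏ i, M (c.partSize i))) *
          ((c.length.factorial : ℝ) * ∏ i, Cg / Rf * ((c.partSize i).factorial : ℝ)) := by
          simp only [Finset.prod_mul_distrib, Finset.prod_pow_eq_pow_sum, hsize,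
            Finset.prod_const, Finset.card_univ, Fintype.card_fin, div_eq_mul_inv]
          ring
      _ ≤ _ := by
          gcongr
  have hMn := hMpos n
  calc _ ≤ ∑ c : OrderedFinpartition n, (Cf * Rg⁻¹ ^ n * M n) * ((c.length.factorial : ℝ) *
        ∏ i, Cg / Rf * ((c.partSize i).factorial : ℝ)) := Finset.sum_le_sum fun c _ => hterm c
    _ ≤ (Cf * Rg⁻¹ ^ n * M n) * ((n.factorial : ℝ) * (Cg / Rf + 2) ^ n) := by
        rw [← Finset.mul_sum]
        gcongr
        exact OrderedFinpartition.sum_factorial_mul_prod_le (by positivity) n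
    _ = Cf * (Rg / (Cg / Rf + 2))⁻¹ ^ n * (n.factorial : ℝ) * M n := by
        rw [inv_div, div_eq_mul_inv (_ + _), mul_pow]
        ring
end

section
/- Let Ω ⊂ ℝ³ be open, let ω₀ : Ω → ℝ³, and for each integer s ≥ 1 let ξ^{(s)} : Ω → ℝ³ be a C¹ vector field. Suppose there is ρ > 0 such that for every a ∈ Ω the series ξ(t,a) = Σ_{s≥1} ξ^{(s)}(a) t^s and the termwise differentiated series Σ_{s≥1} ∇ξ^{(s)}(a) t^s and Σ_{s≥1} s·ξ^{(s)}(a) t^{s−1} converge for |t| < ρ, with ∇ξ(t,a) = Σ_{s≥1} ∇ξ^{(s)}(a) t^s and ∂_t ξ(t,a) = Σ_{s≥1} s·ξ^{(s)}(a) t^{s−1}, and that ξ satisfies the Cauchy invariants equation ∇×(∂_t ξ)(t,·) + Σ_{k=1}^{3} ∇(∂_t ξ_k)(t,·) × ∇ξ_k(t,·) = ω₀ on Ω for all |t| < ρ. Then for every s ≥ 1 the curl recursion relation holds on Ω: ∇×ξ^{(s)} = δ_{1s}·ω₀ − (1/2) Σ_{k=1}^{3} Σ_{m=1}^{s−1}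 ((2m−s)/s) · ∇ξ_k^{(m)} × ∇ξ_k^{(s−m)}, where δ_{1s} is the Kronecker symbol. -/
open Set

noncomputable section

/-- Partial derivative of a scalar field in the `i`-th coordinate direction. -/
noncomputable def pd3 (i : Fin 3) (f : (Fin 3 → ℝ) → ℝ) (x : Fin 3 → ℝ) : ℝ :=
  fderiv ℝ f x (Pi.single i 1)

/-- Gradient of a scalar field. -/
noncomputable def grad3 (f : (Fin 3 → ℝ) → ℝ) (x : Fin 3 → ℝ) : Fin 3 → ℝ :=
  fun i => pd3 i f x

/-- Cross product in `ℝ³`. -/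
def cross3 (u v : Fin 3 → ℝ) : Fin 3 → ℝ :=
  ![u 1 * v 2 - u 2 * v 1, u 2 * v 0 - u 0 * v 2, u 0 * v 1 - u 1 * v 0]

/-- Curl of a vector field on `ℝ³`. -/
noncomputable def curl3 (u : (Fin 3 → ℝ) → (Fin 3 → ℝ)) (x : Fin 3 → ℝ) : Fin 3 → ℝ :=
  ![pd3 1 (fun y => u y 2) x - pd3 2 (fun y => u y 1) x,
    pd3 2 (fun y => u y 0) x - pd3 0 (fun y => u y 2) x,
    pd3 0 (fun y => u y 1) x - pd3 1 (fun y => u y 0) x]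

theorem eq_zero_of_hasSum_pow_mul_const {c : ℕ → ℝ} {w : ℝ}
    (h : ∀ᶠ t in nhds (0 : ℝ), HasSum (fun n => t ^ n * c n) w) {n : ℕ} (hn : n ≠ 0) :
    c n = 0 := by
  have h₁ : HasFPowerSeriesAt (fun _ : ℝ => w) (FormalMultilinearSeries.ofScalars ℝ c) 0 := by
    rw [hasFPowerSeriesAt_iff]
    simpa [FormalMultilinearSeries.coeff_ofScalars] using h
  have h₂ := h₁.eq_formalMultilinearSeries hasFPowerSeriesAt_const
  rw [← FormalMultilinearSeries.coeff_ofScalars (𝕜 := ℝ) (p := c) (n := n), h₂,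
    FormalMultilinearSeries.coeff, constFormalMultilinearSeries_apply_of_nonzero hn]
  rfl

/-- A pointwise bounded family of continuous functions on an open subset of a Baire space is
uniformly bounded on some nonempty open subset. -/
theorem IsOpen.exists_isOpen_uniform_bound {X ι : Type*} [TopologicalSpace X] [BaireSpace X]
    {U : Set X} (hU : IsOpen U) (hne : U.Nonempty) {f : ι → X → ℝ}
    (hf : ∀ i, ContinuousOn (f i) U) (hb : ∀ x ∈ U, ∃ C : ℝ, ∀ i, |f i x| ≤ C) :
    ∃ N : ℝ, ∃ V ⊆ U, IsOpen V ∧ V.Nonempty ∧ ∀ x ∈ V, ∀ i, |f i x| ≤ N := by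
  have := hU.baireSpace
  have := hne.to_subtype
  obtain ⟨N, x, hx⟩ := nonempty_interior_of_iUnion_of_closed
    (f := fun N : ℕ => ⋂ i, {x : U | |f i x| ≤ N})
    (fun N => isClosed_iInter fun i =>
      isClosed_le (hf i).domRestrict.abs continuous_const)
    (by
      refine eq_univ_of_forall fun x => ?_
      obtain ⟨C, hC⟩ := hb x x.2
      obtain ⟨N, hN⟩ := exists_nat_ge C
      exact mem_iUnion.2 ⟨N, mem_iInter.2 fun i => (hC i).trans hN⟩)
  refine ⟨N, Subtype.val '' interior (⋂ i, {x : U | |f i x| ≤ N}), by simp,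
    hU.isOpenMap_subtype_val _ isOpen_interior, ⟨x, x, hx, rfl⟩, ?_⟩
  rintro _ ⟨y, hy, rfl⟩ i
  exact mem_iInter.1 (interior_subset hy) i

theorem hasSum_derivSeries_mul_series {p q : ℕ → ℝ} {t A B : ℝ}
    (hA : HasSum (fun n : ℕ => ((n : ℝ) + 1) * t ^ n * p (n + 1)) A)
    (hB : HasSum (fun n : ℕ => t ^ (n + 1) * q (n + 1)) B) :
    HasSum (fun n : ℕ => t ^ n * ∑ m ∈ Finset.Ioo 0 (n + 1), (m : ℝ) * (p m * q (n + 1 - m)))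
      (A * B) := by
  set g : ℕ → ℝ := fun n => if n = 0 then 0 else t ^ n * q n with hg
  have hB' : HasSum g B := by
    rw [← hasSum_nat_add_iff' 1]
    simpa [hg] using hB
  have key := hasSum_sum_range_mul_of_summable_norm hA.summable.norm hB'.summable.norm
  rw [hA.tsum_eq, hB'.tsum_eq] at key
  refine (congrArg (HasSum · (A * B)) (funext fun n => ?_)).mp key
  rw [Finset.sum_range_succ, ← Finset.Ico_succ_left_eq_Ioo, Finset.sum_Ico_eq_sum_range,
    Finset.mul_sum]
  simp only [hg, Nat.sub_self, if_true, mul_zero, add_zero]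
  refine Finset.sum_congr (by simp) fun k hk => ?_
  have hkn : k < n := Finset.mem_range.1 (by simpa using hk)
  have h₁ : n + 1 - (Order.succ 0 + k) = n - k := by simp; omega
  rw [if_neg (by omega), h₁, ← Nat.add_sub_cancel' hkn.le, Nat.add_sub_cancel_left, pow_add]
  simp only [Nat.succ_eq_succ, Nat.succ_eq_add_one, zero_add, add_comm 1 k]
  push_cast
  ring

theorem sum_Ioo_mul_antisymm {c : ℕ → ℕ → ℝ} (hc : ∀ m n, c m n = -c n m) (s : ℕ) :
    ∑ m ∈ Finset.Ioo 0 s, (m : ℝ) * c m (s - m) =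
      2⁻¹ * ∑ m ∈ Finset.Ioo 0 s, (2 * (m : ℝ) - s) * c m (s - m) := by
  have h : ∑ m ∈ Finset.Ioo 0 s, (m : ℝ) * c m (s - m) =
      ∑ m ∈ Finset.Ioo 0 s, ((s : ℝ) - m) * -c m (s - m) := by
    refine Finset.sum_nbij' (fun m => s - m) (fun m => s - m) ?_ ?_ ?_ ?_ ?_
    any_goals
      intro m hm
      simp only [Finset.mem_Ioo] at hm ⊢
      omega
    intro m hm
    simp only [Finset.mem_Ioo] at hm
    rw [Nat.sub_sub_self hm.2.le, ← hc, Nat.cast_sub hm.2.le]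
    ring
  rw [show ∑ m ∈ Finset.Ioo 0 s, (2 * (m : ℝ) - s) * c m (s - m) =
      ∑ m ∈ Finset.Ioo 0 s, (m : ℝ) * c m (s - m) +
        ∑ m ∈ Finset.Ioo 0 s, ((s : ℝ) - m) * -c m (s - m) by
    rw [← Finset.sum_add_distrib]; exact Finset.sum_congr rfl fun m _ => by ring, ← h]
  ring

theorem norm_le_sum_abs_apply_single (L : (Fin 3 → ℝ) →L[ℝ] ℝ) :
    ‖L‖ ≤ ∑ i, |L (Pi.single i 1)| := by
  refine L.opNorm_le_bound (Finset.sum_nonneg fun i _ => abs_nonneg _) fun x => ?_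
  have hx : L x = ∑ i, x i * L (Pi.single i 1) := by
    conv_lhs => rw [pi_eq_sum_univ' x, map_sum]
    simp
  rw [hx, Finset.sum_mul]
  refine (norm_sum_le _ _).trans (Finset.sum_le_sum fun i _ => ?_)
  rw [norm_mul, mul_comm]
  exact mul_le_mul_of_nonneg_left (norm_le_pi_norm x i) (abs_nonneg _)

theorem hasSum_pd3_derivSeries {V : Set (Fin 3 → ℝ)} (hV : IsOpen V)
    {φ : ℕ → (Fin 3 → ℝ) → ℝ} {F : (Fin 3 → ℝ) → ℝ}
    (hφ : ∀ n, ∀ y ∈ V, DifferentiableAt ℝ (φ n) y) {r N t : ℝ} (hr : 0 < r)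
    (hN : ∀ y ∈ V, ∀ (n : ℕ) (i : Fin 3), |r ^ n * pd3 i (φ n) y| ≤ N) (ht : |t| < r)
    (hF : ∀ y ∈ V, HasSum (fun n : ℕ => ((n : ℝ) + 1) * t ^ n * φ n y) (F y))
    {b : Fin 3 → ℝ} (hb : b ∈ V) (i : Fin 3) :
    HasSum (fun n : ℕ => ((n : ℝ) + 1) * t ^ n * pd3 i (φ n) b) (pd3 i F b) := by
  obtain ⟨ε, hε, hball⟩ := Metric.isOpen_iff.1 hV b hb
  set u : ℕ → ℝ := fun n => 3 * N * (((n : ℝ) + 1) * (|t| / r) ^ n) with hu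
  have hq : ‖|t| / r‖ < 1 := by
    rw [Real.norm_of_nonneg (by positivity)]
    exact (div_lt_one hr).2 ht
  have husum : Summable u := by
    refine Summable.mul_left _ ?_
    simpa [add_mul] using (summable_pow_mul_geometric_of_norm_lt_one 1 hq).add
      (summable_pow_mul_geometric_of_norm_lt_one 0 hq)
  have hbound : ∀ n : ℕ, ∀ y ∈ Metric.ball b ε,
      ‖(((n : ℝ) + 1) * t ^ n) • fderiv ℝ (φ n) y‖ ≤ u n := by
    intro n y hy
    have h₁ : ‖fderiv ℝ (φ n) y‖ ≤ 3 * (N / r ^ n) := by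
      refine (norm_le_sum_abs_apply_single _).trans ?_
      refine (Finset.sum_le_card_nsmul _ _ (N / r ^ n) fun j _ => ?_).trans (by simp)
      have := hN y (hball hy) n j
      rw [abs_mul, abs_of_pos (pow_pos hr n)] at this
      rw [le_div_iff₀' (pow_pos hr n)]
      exact this
    rw [norm_smul, norm_mul, norm_pow, Real.norm_of_nonneg (by positivity : (0 : ℝ) ≤ n + 1)]
    refine (mul_le_mul_of_nonneg_left h₁ (by positivity)).trans_eq ?_
    simp only [hu, Real.norm_eq_abs, div_pow]
    field_simp
  have hderiv := hasFDerivAt_tsum_of_isPreconnected (𝕜 := ℝ)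
    (f := fun (n : ℕ) y => ((n : ℝ) + 1) * t ^ n * φ n y) husum Metric.isOpen_ball
    (convex_ball b ε).isPreconnected
    (fun n y hy => (hφ n y (hball hy)).hasFDerivAt.const_mul _) hbound
    (Metric.mem_ball_self hε) (hF b hb).summable (Metric.mem_ball_self hε)
  have heq : F =ᶠ[nhds b] fun y => ∑' n : ℕ, ((n : ℝ) + 1) * t ^ n * φ n y :=
    Filter.eventually_of_mem (hV.mem_nhds hb) fun y hy => (hF y hy).tsum_eq.symm
  have hs := (Summable.of_norm_bounded husum
    fun n => hbound n b (Metric.mem_ball_self hε)).hasSum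
  rw [← (hderiv.congr_of_eventuallyEq heq).fderiv] at hs
  exact hs.mapL (ContinuousLinearMap.apply ℝ ℝ (Pi.single i (1 : ℝ)))

theorem curl3_apply (u : (Fin 3 → ℝ) → (Fin 3 → ℝ)) (x : Fin 3 → ℝ) (l : Fin 3) :
    curl3 u x l = pd3 (l + 1) (fun y => u y (l + 2)) x - pd3 (l + 2) (fun y => u y (l + 1)) x := by
  fin_cases l <;> rfl

theorem cross3_apply (u v : Fin 3 → ℝ) (l : Fin 3) :
    cross3 u v l = u (l + 1) * v (l + 2) - u (l + 2) * v (l + 1) := by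
  fin_cases l <;> rfl

theorem coeff_antisymm_recursion {p : Fin 3 → Fin 3 → ℕ → ℝ} {A B : ℝ → Fin 3 → Fin 3 → ℝ}
    {r w : ℝ} (hr : 0 < r)
    (hA : ∀ t, |t| < r → ∀ i k,
      HasSum (fun n : ℕ => ((n : ℝ) + 1) * t ^ n * p i k (n + 1)) (A t i k))
    (hB : ∀ t, |t| < r → ∀ i k, HasSum (fun n : ℕ => t ^ (n + 1) * p i k (n + 1)) (B t i k))
    {i j : Fin 3}
    (h : ∀ t, |t| < r →
      A t i j - A t j i + ∑ k, (A t i k * B t j k - A t j k * B t i k) = w)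
    {s : ℕ} (hs : 2 ≤ s) :
    p i j s - p j i s = -(2⁻¹ * ∑ k, ∑ m ∈ Finset.Ioo 0 s,
      (2 * (m : ℝ) - s) / s * (p i k m * p j k (s - m) - p j k m * p i k (s - m))) := by
  set c : ℕ → ℝ := fun n => ((n : ℝ) + 1) * (p i j (n + 1) - p j i (n + 1)) +
    ∑ k, (∑ m ∈ Finset.Ioo 0 (n + 1), (m : ℝ) * (p i k m * p j k (n + 1 - m)) -
      ∑ m ∈ Finset.Ioo 0 (n + 1), (m : ℝ) * (p j k m * p i k (n + 1 - m))) with hc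
  have hsum : ∀ᶠ t in nhds (0 : ℝ), HasSum (fun n => t ^ n * c n) w := by
    filter_upwards [Metric.ball_mem_nhds (0 : ℝ) hr] with t ht
    replace ht : |t| < r := by simpa using ht
    have h₁ := ((hA t ht i j).sub (hA t ht j i)).add
      (hasSum_sum (s := Finset.univ) fun k _ =>
        (hasSum_derivSeries_mul_series (hA t ht i k) (hB t ht j k)).sub
          (hasSum_derivSeries_mul_series (hA t ht j k) (hB t ht i k)))
    rw [h t ht] at h₁
    refine (congrArg (HasSum · w) (funext fun n => ?_)).mp h₁
    simp only [hc, mul_add, Finset.mul_sum (s := Finset.univ), mul_sub]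
    ring
  obtain ⟨n, rfl⟩ : ∃ n, s = n + 1 := ⟨s - 1, by omega⟩
  have h₀ := eq_zero_of_hasSum_pow_mul_const hsum (n := n) (by omega)
  have hk : ∀ k, ∑ m ∈ Finset.Ioo 0 (n + 1), (m : ℝ) * (p i k m * p j k (n + 1 - m)) -
      ∑ m ∈ Finset.Ioo 0 (n + 1), (m : ℝ) * (p j k m * p i k (n + 1 - m)) =
      2⁻¹ * (((n : ℝ) + 1) * ∑ m ∈ Finset.Ioo 0 (n + 1), (2 * (m : ℝ) - (n + 1 : ℕ)) / (n + 1 : ℕ) *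
        (p i k m * p j k (n + 1 - m) - p j k m * p i k (n + 1 - m))) := by
    intro k
    have hsymm := sum_Ioo_mul_antisymm (c := fun m n => p i k m * p j k n - p j k m * p i k n)
      (fun m n => by ring) (n + 1)
    rw [← Finset.sum_sub_distrib]
    simp only [← mul_sub]
    rw [hsymm, Finset.mul_sum (a := (n : ℝ) + 1)]
    congr 1
    refine Finset.sum_congr rfl fun m _ => ?_
    push_cast
    field_simp
  simp only [hc, hk] at h₀
  rw [← Finset.mul_sum, ← Finset.mul_sum] at h₀
  have hn : (n : ℝ) + 1 ≠ 0 := by positivity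
  refine mul_left_cancel₀ hn ?_
  linear_combination h₀

/-- The Cauchy invariants equation for the displacement series
`ξ(t,a) = Σ_{s≥1} ξ^{(s)}(a) t^s` implies, order by order, the curl recursion relations
`∇×ξ^{(s)} = δ_{1s} ω₀ − ½ Σ_k Σ_{0<m<s} ((2m−s)/s) ∇ξ_k^{(m)} × ∇ξ_k^{(s−m)}`. -/
theorem cauchy_invariants_curl_recursion
    (Ω : Set (Fin 3 → ℝ)) (hΩ : IsOpen Ω)
    (ω₀ : (Fin 3 → ℝ) → (Fin 3 → ℝ))
    (ξc : ℕ → (Fin 3 → ℝ) → (Fin 3 → ℝ))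
    (hreg : ∀ s : ℕ, 1 ≤ s → ∀ a ∈ Ω, ContDiffAt ℝ 1 (ξc s) a)
    (ρ : ℝ) (hρ : 0 < ρ)
    (ξ ξdot : ℝ → (Fin 3 → ℝ) → (Fin 3 → ℝ))
    (hsum : ∀ a ∈ Ω, ∀ t : ℝ, |t| < ρ →
      HasSum (fun n : ℕ => t ^ (n + 1) • ξc (n + 1) a) (ξ t a))
    (hsumgrad : ∀ a ∈ Ω, ∀ t : ℝ, |t| < ρ → ∀ i j : Fin 3,
      HasSum (fun n : ℕ => t ^ (n + 1) * pd3 i (fun y => ξc (n + 1) y j) a)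
        (pd3 i (fun y => ξ t y j) a))
    (hsumdt : ∀ a ∈ Ω, ∀ t : ℝ, |t| < ρ →
      HasSum (fun n : ℕ => (((n : ℝ) + 1) * t ^ n) • ξc (n + 1) a) (ξdot t a))
    (hdt : ∀ a ∈ Ω, ∀ t : ℝ, |t| < ρ → HasDerivAt (fun τ => ξ τ a) (ξdot t a) t)
    (hcauchy : ∀ t : ℝ, |t| < ρ → ∀ a ∈ Ω,
      curl3 (ξdot t) a +
        ∑ k : Fin 3, cross3 (grad3 (fun y => ξdot t y k) a) (grad3 (fun y => ξ t y k) a)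
      = ω₀ a) :
    ∀ s : ℕ, 1 ≤ s → ∀ a ∈ Ω,
      curl3 (ξc s) a =
        (if s = 1 then ω₀ a else 0) -
          (2⁻¹ : ℝ) • ∑ k : Fin 3, ∑ m ∈ Finset.Ioo 0 s,
            ((2 * (m : ℝ) - (s : ℝ)) / (s : ℝ)) •
              cross3 (grad3 (fun y => ξc m y k) a) (grad3 (fun y => ξc (s - m) y k) a) := by
  have hdiff : ∀ s, 1 ≤ s → ∀ a ∈ Ω, ∀ k, ContDiffAt ℝ 1 (fun y => ξc s y k) a :=
    fun s hs a ha k => contDiffAt_pi.1 (hreg s hs a ha) k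
  have hcont : ∀ s, 1 ≤ s → ∀ i k, ContinuousOn (pd3 i fun y => ξc s y k) Ω :=
    fun s hs i k a ha => (((hdiff s hs a ha k).continuousAt_fderiv one_ne_zero).clm_apply
      continuousAt_const).continuousWithinAt
  have hzero : |(0 : ℝ)| < ρ := by simpa using hρ
  intro s hs a ha
  obtain rfl | hs₂ : s = 1 ∨ 2 ≤ s := by omega
  · have hξ : (ξ 0) =ᶠ[nhds a] 0 := by
      filter_upwards [hΩ.mem_nhds ha] with y hy
      exact (hsum y hy 0 hzero).unique (by simp)
    have hξdot : ξdot 0 =ᶠ[nhds a] ξc 1 := by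
      filter_upwards [hΩ.mem_nhds ha] with y hy
      refine (hsumdt y hy 0 hzero).unique ?_
      convert hasSum_single (f := fun n : ℕ => (((n : ℝ) + 1) * 0 ^ n) • ξc (n + 1) y) 0 ?_ using 1
      · simp
      · intro n hn
        simp [hn]
    have hpd : ∀ i k, pd3 i (fun y => ξdot 0 y k) a = pd3 i (fun y => ξc 1 y k) a := by
      intro i k
      simp only [pd3]
      exact DFunLike.congr_fun (hξdot.fun_comp (· k)).fderiv_eq _
    have hpd₀ : ∀ i k, pd3 i (fun y => ξ 0 y k) a = 0 := by
      intro i k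
      simp only [pd3]
      refine (DFunLike.congr_fun (hξ.fun_comp (· k)).fderiv_eq _).trans ?_
      simp [Function.comp_def]
    have := hcauchy 0 hzero a ha
    ext l
    rw [← this]
    simp [curl3_apply, cross3_apply, grad3, hpd, hpd₀,
      (by decide : Finset.Ioo 0 1 = (∅ : Finset ℕ))]
  · ext l
    set D : (Fin 3 → ℝ) → ℝ := fun x =>
      pd3 (l + 1) (fun y => ξc s y (l + 2)) x - pd3 (l + 2) (fun y => ξc s y (l + 1)) x +
        2⁻¹ * ∑ k : Fin 3, ∑ m ∈ Finset.Ioo 0 s, (2 * (m : ℝ) - s) / s *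
          (pd3 (l + 1) (fun y => ξc m y k) x * pd3 (l + 2) (fun y => ξc (s - m) y k) x -
            pd3 (l + 2) (fun y => ξc m y k) x * pd3 (l + 1) (fun y => ξc (s - m) y k) x) with hD
    suffices hDa : D a = 0 by
      simp only [curl3_apply, if_neg (by omega : s ≠ 1), Pi.sub_apply, Pi.zero_apply,
        Pi.smul_apply, Finset.sum_apply, cross3_apply, grad3, smul_eq_mul]
      linear_combination hDa
    have hDcont : ContinuousOn D Ω := by
      refine ((hcont s hs _ _).sub (hcont s hs _ _)).add (continuousOn_const.mul ?_)
      refine continuousOn_finsetSum _ fun k _ => continuousOn_finsetSum _ fun m hm => ?_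
      obtain ⟨hm₀, hms⟩ := Finset.mem_Ioo.1 hm
      have hsm : 1 ≤ s - m := by omega
      exact continuousOn_const.mul (((hcont m hm₀ _ _).mul (hcont _ hsm _ _)).sub
        ((hcont m hm₀ _ _).mul (hcont _ hsm _ _)))
    by_contra hne
    set r := ρ / 2 with hr
    have hr₀ : 0 < r := half_pos hρ
    have hrρ : r < ρ := half_lt_self hρ
    have hUopen : IsOpen (Ω ∩ D ⁻¹' {0}ᶜ) := hDcont.isOpen_inter_preimage hΩ isOpen_compl_singleton
    obtain ⟨N, V, hVU, hV, ⟨b, hb⟩, hN⟩ := hUopen.exists_isOpen_uniform_bound ⟨a, ha, hne⟩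
      (f := fun (q : ℕ × Fin 3 × Fin 3) x =>
        r ^ q.1 * pd3 q.2.1 (fun y => ξc (q.1 + 1) y q.2.2) x)
      (fun q => continuousOn_const.mul
        ((hcont _ (by omega) _ _).mono inter_subset_left)) (by
        intro x hx
        have hbdd : ∀ q : Fin 3 × Fin 3, ∃ C : ℝ, ∀ n : ℕ,
            |r ^ n * pd3 q.1 (fun y => ξc (n + 1) y q.2) x| ≤ C := by
          intro q
          have hsummable := (hsumgrad x hx.1 r (by rwa [abs_of_pos hr₀]) q.1 q.2).summable
          obtain ⟨C, hC⟩ := hsummable.tendsto_atTop_zero.norm.bddAbove_range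
          refine ⟨C / r, fun n => ?_⟩
          rw [le_div_iff₀ hr₀]
          refine le_of_eq_of_le ?_ (hC ⟨n, rfl⟩)
          rw [← abs_of_pos hr₀, ← abs_mul, abs_of_pos hr₀]
          exact congrArg abs (by ring)
        choose C hC using hbdd
        refine ⟨∑ q, |C q|, fun q => ((hC q.2 q.1).trans (le_abs_self _)).trans ?_⟩
        exact Finset.single_le_sum (f := fun q => |C q|) (fun _ _ => abs_nonneg _)
          (Finset.mem_univ q.2))
    have hVΩ : V ⊆ Ω := hVU.trans inter_subset_left
    refine (hVU hb).2 ?_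
    have hrec := coeff_antisymm_recursion (p := fun i k n => pd3 i (fun y => ξc n y k) b)
      (A := fun t i k => pd3 i (fun y => ξdot t y k) b)
      (B := fun t i k => pd3 i (fun y => ξ t y k) b) (w := ω₀ b l) (i := l + 1) (j := l + 2) hr₀
      (fun t ht i k => hasSum_pd3_derivSeries hV
        (fun n y hy => (hdiff (n + 1) (by omega) y (hVΩ hy) k).differentiableAt one_ne_zero) hr₀
        (fun y hy n i => hN y hy (n, i, k)) ht
        (fun y hy => by
          simpa using Pi.hasSum.1 (hsumdt y (hVΩ hy) t (ht.trans hrρ)) k) hb i)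
      (fun t ht i k => hsumgrad b (hVΩ hb) t (ht.trans hrρ) i k)
      (fun t ht => by
        rw [← hcauchy t (ht.trans hrρ) b (hVΩ hb)]
        simp only [Pi.add_apply, Finset.sum_apply, curl3_apply, cross3_apply, grad3]) hs₂
    simp only [mem_singleton_iff, hD]
    linear_combination hrec

end
end
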